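/- In the standing setup with the martingale limits L_∞ and M_∞: the cylinder specifications P(X_0 = a_0, …, X_k = a_k | Z) = L_∞(a_0,…,a_k) are consistent almost surely and define a measurable family of probability measures ν(Z) on A^ℕ that is a regular conditional distribution (disintegration) of the law of X̄ given the image process f(X̄) = Z; in particular ν(Z) is almost surely supported on {(a_i)_{i≥0} ∈ A^ℕ : f(a_i) = Z_i for all i} and ∫ ν(z) dμ_Z(z) equals the law of X̄. The analogous statement holds for M_∞ and Ȳ given g(Ȳ) = Z, and the products N_∞((a_0,b_0),…,(a_k,b_k)) = L_∞(a_0,…,a_k)·M_∞(b_0,…,b_k) define a measurable family of probability measures ξ(Z) on (A×B)^ℕ, almost surely supported on the paths in Δ'^ℕ projecting to Z, that disintegrates the law of the coupled chain W = MC(α,P) over Z. -/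

import Mathlib

open MeasureTheory Filter Topology
open scoped ENNReal Classical

/-- A probability vector on a countable state space. -/
def IsProbVec {U : Type*} (v : U → ℝ≥0∞) : Prop := ∑' u, v u = 1

/-- A row-stochastic matrix on a countable state space. -/
def IsStochastic {U : Type*} (P : U → U → ℝ≥0∞) : Prop := ∀ u, ∑' w, P u w = 1

/-- `μ` is the law of the time-homogeneous Markov chain `MC(v,P)`. -/
def IsMarkovChain {U : Type*} [MeasurableSpace U]
    (v : U → ℝ≥0∞) (P : U → U → ℝ≥0∞) (μ : Measure (ℕ → U)) : Prop :=
  IsProbabilityMeasure μ ∧ IsProbVec v ∧ IsStochastic P ∧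
    ∀ (k : ℕ) (a : ℕ → U),
      μ {ω | ∀ i ≤ k, ω i = a i} = v (a 0) * ∏ i ∈ Finset.range k, P (a i) (a (i + 1))

/-- The conditional probability of the cylinder event `{X_0 = a_0, …, X_k = a_k}` given
`f(X_0) = z_0, …, f(X_m) = z_m`, as a function of the image trajectory `z`.  (For `μ_Z`-a.e.
`z` the conditioning event has positive probability and this ratio is the usual elementary
conditional probability; these are the martingales `L_m`, resp. `M_m`.) -/
noncomputable def condCyl {A C : Type*} [MeasurableSpace A]
    (μ : Measure (ℕ → A)) (f : A → C) (z : ℕ → C) (m k : ℕ) (a : Fin (k + 1) → A) : ℝ≥0∞ :=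
  μ {ω | (∀ i : Fin (k + 1), ω i.1 = a i) ∧ ∀ j ≤ m, f (ω j) = z j}
    / μ {ω | ∀ j ≤ m, f (ω j) = z j}

/-- `Δ(f,g) = {(a,b) : f a = g b}`. -/
abbrev Delta {A B C : Type*} (f : A → C) (g : B → C) :=
  {p : A × B // f p.1 = g p.2}

/-- The matrix `R` on `Δ(f,g)`. -/
noncomputable def Rmat {A B C : Type*} (PX : A → A → ℝ≥0∞) (PY : B → B → ℝ≥0∞)
    (PZ : C → C → ℝ≥0∞) (f : A → C) (g : B → C) (d e : Delta f g) : ℝ≥0∞ :=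
  if PZ (f d.1.1) (f e.1.1) ≠ 0 then
    PX d.1.1 e.1.1 * PY d.1.2 e.1.2 / PZ (f d.1.1) (f e.1.1)
  else 0

/-- `phim R m = R^m 1`, computed coordinatewise in `[0,∞]`. -/
noncomputable def phim {D : Type*} (R : D → D → ℝ≥0∞) : ℕ → D → ℝ≥0∞
  | 0 => fun _ => 1
  | m + 1 => fun d => ∑' e, R d e * phim R m e

/-- The initial distribution `α` of the coupled chain on `Δ'`. -/
noncomputable def alphaW {A B C : Type*} (αX : A → ℝ≥0∞) (αY : B → ℝ≥0∞) (αZ : C → ℝ≥0∞)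
    (f : A → C) (g : B → C) (φ : Delta f g → ℝ≥0∞) (d : Delta f g) : ℝ≥0∞ :=
  if αZ (f d.1.1) ≠ 0 then αX d.1.1 * αY d.1.2 / αZ (f d.1.1) * φ d else 0

/-- The cylinder of trajectories which agree with `a` up to time `k`. -/
def pathCyl {U : Type*} (k : ℕ) (a : ℕ → U) : Set (ℕ → U) := {ω | ∀ i ≤ k, ω i = a i}

section Cylinders

variable {U : Type*}

lemma pathCyl_eq_preimage_frestrictLe (k : ℕ) (a : ℕ → U) :
    pathCyl k a =
      Preorder.frestrictLe (π := fun _ => U) k ⁻¹' {Preorder.frestrictLe (π := fun _ => U) k a} := by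
  ext ω
  simp [pathCyl, funext_iff]

lemma setOf_forall_fin_eq_pathCyl (k : ℕ) (a : ℕ → U) :
    {ω : ℕ → U | ∀ i : Fin (k + 1), ω i.1 = a i.1} = pathCyl k a := by
  ext ω
  simp [pathCyl, Fin.forall_iff]

lemma pathCyl_congr {k : ℕ} {a b : ℕ → U} (h : ∀ i ≤ k, a i = b i) :
    pathCyl k a = pathCyl k b := by
  ext ω
  exact forall₂_congr fun i hi => by rw [h i hi]

variable [MeasurableSpace U] [MeasurableSingletonClass U]

lemma measurableSet_pathCyl (k : ℕ) (a : ℕ → U) : MeasurableSet (pathCyl k a) := by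
  have : pathCyl k a = ⋂ i, ⋂ (_ : i ≤ k), (fun ω : ℕ → U => ω i) ⁻¹' {a i} := by
    ext ω; simp [pathCyl]
  rw [this]
  exact .iInter fun i => .iInter fun _ => measurable_pi_apply i (measurableSet_singleton _)

/-- Almost every trajectory only passes through cylinders of positive measure. -/
lemma ae_measure_pathCyl_ne_zero [Countable U] (μ : Measure (ℕ → U)) (m : ℕ) :
    ∀ᵐ z ∂μ, μ (pathCyl m z) ≠ 0 := by
  have hr : Measurable (Preorder.frestrictLe (π := fun _ : ℕ => U) m) := by fun_prop
  have h : ∀ᵐ y ∂(μ.map (Preorder.frestrictLe (π := fun _ : ℕ => U) m)),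
      μ.map (Preorder.frestrictLe (π := fun _ : ℕ => U) m) {y} ≠ 0 :=
    ae_iff_of_countable.2 fun _ h => h
  filter_upwards [ae_of_ae_map hr.aemeasurable h] with z hz
  rwa [Measure.map_apply hr (measurableSet_singleton _), ← pathCyl_eq_preimage_frestrictLe] at hz

/-- Any function of the first coordinates of a trajectory in a countable space is measurable. -/
lemma measurable_of_dependsOn_initial [Countable U] {V : Type*} [MeasurableSpace V] (m : ℕ)
    (F : (ℕ → U) → V) (hF : ∀ z z', (∀ i ≤ m, z i = z' i) → F z = F z') : Measurable F := by
  have : F = (fun y : Fin (m + 1) → U => F fun n => y ⟨min n m, by omega⟩) ∘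
      fun z i => z i.1 := by
    ext z
    exact hF _ _ fun i hi => by simp [min_eq_left hi]
  rw [this]
  exact (measurable_of_countable _).comp (by fun_prop)

/-- Two finite measures on a path space over a countable set agree as soon as they agree on
cylinders. -/
lemma measure_ext_of_pathCyl [Countable U] {μ ν : Measure (ℕ → U)} [IsFiniteMeasure μ]
    (h : ∀ k a, μ (pathCyl k a) = ν (pathCyl k a)) : μ = ν := by
  have key : ∀ k, μ.map (Preorder.frestrictLe (π := fun _ => U) k) =
      ν.map (Preorder.frestrictLe (π := fun _ => U) k) := by
    intro k
    have hr : Measurable (Preorder.frestrictLe (π := fun _ : ℕ => U) k) := by fun_prop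
    refine Measure.ext_of_singleton fun y => ?_
    rw [Measure.map_apply hr (measurableSet_singleton _),
      Measure.map_apply hr (measurableSet_singleton _)]
    by_cases hy : ∃ a : ℕ → U, Preorder.frestrictLe (π := fun _ => U) k a = y
    · obtain ⟨a, rfl⟩ := hy
      rw [← pathCyl_eq_preimage_frestrictLe, h]
    · have : Preorder.frestrictLe (π := fun _ => U) k ⁻¹' {y} = ∅ := by
        ext ω
        simpa using fun h => hy ⟨ω, h⟩
      rw [this]; simp
  refine IsProjectiveLimit.unique (P := fun I : Finset ℕ => μ.map I.restrict)
    (fun I => rfl) fun I => ?_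
  have hI : I ⊆ Finset.Iic (I.sup id) := fun i hi =>
    Finset.mem_Iic.2 (Finset.le_sup (f := id) hi)
  have hc : I.restrict (π := fun _ : ℕ => U) =
      Finset.restrict₂ (π := fun _ : ℕ => U) hI ∘ Preorder.frestrictLe (π := fun _ => U) (I.sup id) := rfl
  change ν.map I.restrict = μ.map I.restrict
  rw [hc, ← Measure.map_map (by fun_prop) (by fun_prop),
    ← Measure.map_map (by fun_prop) (by fun_prop), key]

/-- Lévy's upward theorem for the coordinate filtration of a countable path space: averages over
shrinking cylinders converge almost everywhere. -/
lemma tendsto_lintegral_pathCyl_div [Countable U] (μ : Measure (ℕ → U)) [IsProbabilityMeasure μ]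
    (h : (ℕ → U) → ℝ≥0∞) (hm : Measurable h) (h1 : ∀ z, h z ≤ 1) :
    ∀ᵐ z ∂μ, Tendsto (fun m => (∫⁻ x in pathCyl m z, h x ∂μ) / μ (pathCyl m z)) atTop
      (𝓝 (h z)) := by
  set F : (ℕ → U) → ℝ := fun z => (h z).toReal
  have hfin : ∀ z, h z ≠ ∞ := fun z => ((h1 z).trans_lt ENNReal.one_lt_top).ne
  have hFm : Measurable F := hm.ennreal_toReal
  have hFi : Integrable F μ := by
    refine Integrable.of_bound hFm.aestronglyMeasurable 1 (ae_of_all _ fun z => ?_)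
    rw [Real.norm_of_nonneg ENNReal.toReal_nonneg]
    exact ENNReal.toReal_le_of_le_ofReal zero_le_one (by simpa using h1 z)
  let ℱ : Filtration ℕ (MeasurableSpace.pi (X := fun _ : ℕ => U)) := Filtration.piLE
  have hseq : ∀ m, ℱ m = MeasurableSpace.pi.comap (Preorder.frestrictLe m) :=
    fun m => Filtration.piLE_eq_comap_frestrictLe m
  have hsup : ⨆ m, ℱ m = MeasurableSpace.pi (X := fun _ : ℕ => U) := by
    refine le_antisymm (iSup_le fun m => ℱ.le m) ?_
    refine iSup_le fun i => le_trans ?_ (le_iSup _ i)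
    rw [hseq i]
    rintro _ ⟨s, hs, rfl⟩
    exact ⟨(fun y : (j : Finset.Iic i) → U => y ⟨i, by simp⟩) ⁻¹' s,
      measurable_pi_apply _ hs, rfl⟩
  have hlevy := tendsto_ae_condExp (μ := μ) (ℱ := ℱ) F
  have hlim : μ[F | ⨆ m, ℱ m] = F := by
    rw [hsup]
    exact condExp_of_stronglyMeasurable le_rfl hFm.stronglyMeasurable hFi
  rw [hlim] at hlevy
  have hpos : ∀ᵐ z ∂μ, ∀ m, μ (pathCyl m z) ≠ 0 :=
    ae_all_iff.2 fun m => ae_measure_pathCyl_ne_zero μ m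
  filter_upwards [hlevy, hpos] with z hz hz0
  have hne : ∀ m, (∫⁻ x in pathCyl m z, h x ∂μ) ≠ ∞ := fun m => by
    refine ne_top_of_le_ne_top ENNReal.one_ne_top ?_
    calc ∫⁻ x in pathCyl m z, h x ∂μ ≤ ∫⁻ x in pathCyl m z, 1 ∂μ := lintegral_mono h1
      _ ≤ 1 := by simpa using prob_le_one
  rw [← ENNReal.tendsto_toReal_iff (fun m => ENNReal.div_ne_top (hne m) (hz0 m)) (hfin z)]
  refine hz.congr fun m => ?_
  have hsm : MeasurableSet[ℱ m] (pathCyl m z) := by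
    rw [hseq m]
    exact ⟨_, measurableSet_singleton _, (pathCyl_eq_preimage_frestrictLe m z).symm⟩
  have hconst : ∀ x ∈ pathCyl m z, (μ[F | ℱ m]) x = (μ[F | ℱ m]) z := by
    intro x hx
    have hE : MeasurableSet[ℱ m] ((μ[F | ℱ m]) ⁻¹' {(μ[F | ℱ m]) z}) :=
      stronglyMeasurable_condExp.measurable (measurableSet_singleton _)
    rw [hseq m] at hE
    obtain ⟨T, -, hT⟩ := hE
    have hzT : z ∈ Preorder.frestrictLe (π := fun _ => U) m ⁻¹' T := by rw [hT]; rfl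
    have hxz : Preorder.frestrictLe (π := fun _ => U) m x =
        Preorder.frestrictLe (π := fun _ => U) m z := by
      rwa [pathCyl_eq_preimage_frestrictLe] at hx
    have hxT : x ∈ Preorder.frestrictLe (π := fun _ => U) m ⁻¹' T := by
      rw [Set.mem_preimage, hxz]; exact hzT
    rw [hT] at hxT
    rw [hseq m]
    exact hxT
  have hint := setIntegral_condExp (ℱ.le m) hFi hsm
  rw [setIntegral_congr_fun (measurableSet_pathCyl m z) hconst, setIntegral_const, smul_eq_mul,
    integral_toReal hm.aemeasurable (ae_of_all _ fun x => (hfin x).lt_top)] at hint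
  rw [ENNReal.toReal_div, ← hint, measureReal_def, mul_div_cancel_left₀]
  exact ENNReal.toReal_ne_zero.2 ⟨hz0 m, measure_ne_top _ _⟩

end Cylinders

section Disintegration

open ProbabilityTheory

variable {A C : Type*} [Countable A] [Countable C] [MeasurableSpace A] [MeasurableSingletonClass A]
  [MeasurableSpace C] [MeasurableSingletonClass C]

/-- The law of a process disintegrates over the law of its image under a coordinatewise map, and
the disintegration is the limit of the elementary conditional probabilities. -/
lemma exists_disintegration (μ : Measure (ℕ → A)) [IsProbabilityMeasure μ] (f : A → C)
    (μZ : Measure (ℕ → C)) (hμZ : μ.map (fun ω n => f (ω n)) = μZ) :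
    ∃ ν : Kernel (ℕ → C) (ℕ → A), IsMarkovKernel ν ∧
      (∀ (k : ℕ) (a : Fin (k + 1) → A), ∀ᵐ z ∂μZ, Tendsto (fun m => condCyl μ f z m k a) atTop
        (𝓝 (ν z {ω | ∀ i : Fin (k + 1), ω i.1 = a i}))) ∧
      (∀ᵐ z ∂μZ, ν z {ω | ∀ i : ℕ, f (ω i) = z i} = 1) ∧
      (∀ s : Set (ℕ → A), MeasurableSet s → ∫⁻ z, ν z s ∂μZ = μ s) := by
  subst hμZ
  have hfm : Measurable f := measurable_of_countable f
  have hF : Measurable (fun (ω : ℕ → A) (n : ℕ) => f (ω n)) := by fun_prop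
  have : Nonempty (ℕ → A) := nonempty_of_isProbabilityMeasure μ
  have : IsProbabilityMeasure (μ.map fun ω n => f (ω n)) :=
    Measure.isProbabilityMeasure_map hF.aemeasurable
  set ν := condDistrib (fun ω : ℕ → A => ω) (fun ω n => f (ω n)) μ with hν
  have hcomp := compProd_map_condDistrib (X := fun (ω : ℕ → A) n => f (ω n))
    (Y := fun ω : ℕ → A => ω) (μ := μ) (mβ := MeasurableSpace.pi) aemeasurable_id
  rw [← hν] at hcomp
  have hpair : Measurable fun ω : ℕ → A => ((fun n => f (ω n) : ℕ → C), ω) := by fun_prop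
  have hset : ∀ (s : Set (ℕ → C)) (t : Set (ℕ → A)), MeasurableSet s → MeasurableSet t →
      ∫⁻ z in s, ν z t ∂(μ.map fun ω n => f (ω n)) = μ ((fun ω n => f (ω n)) ⁻¹' s ∩ t) := by
    intro s t hs ht
    rw [← Measure.compProd_apply_prod hs ht, hcomp, Measure.map_apply hpair (hs.prod ht)]
    rfl
  refine ⟨ν, inferInstance, fun k a => ?_, ?_, fun s hs => ?_⟩
  · have hcyl : MeasurableSet {ω : ℕ → A | ∀ i : Fin (k + 1), ω i.1 = a i} := by
      rw [Set.ofPred_forall]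
      exact .iInter fun i => measurableSet_eq_fun (by fun_prop) measurable_const
    filter_upwards [tendsto_lintegral_pathCyl_div (μ.map fun ω n => f (ω n))
      (fun z => ν z {ω | ∀ i : Fin (k + 1), ω i.1 = a i}) (ν.measurable_coe hcyl)
      (fun z => prob_le_one)] with z hz
    refine hz.congr fun m => ?_
    rw [hset _ _ (measurableSet_pathCyl m z) hcyl,
      Measure.map_apply hF (measurableSet_pathCyl m z), condCyl, Set.inter_comm]
    rfl
  · have hmeas : MeasurableSet {p : (ℕ → C) × (ℕ → A) | ∀ i, f (p.2 i) = p.1 i} := by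
      rw [Set.ofPred_forall]
      exact .iInter fun i => measurableSet_eq_fun (by fun_prop) (by fun_prop)
    have hae : ∀ᵐ p ∂((μ.map fun ω n => f (ω n)) ⊗ₘ ν), ∀ i, f (p.2 i) = p.1 i := by
      rw [hcomp, ae_map_iff hpair.aemeasurable hmeas]
      exact ae_of_all _ fun ω i => rfl
    filter_upwards [Measure.ae_ae_of_ae_compProd hae] with z hz
    exact (mem_ae_iff_prob_eq_one (measurable_prodMk_left (x := z) hmeas)).1 hz
  · simpa using hset Set.univ s .univ hs

end Disintegration

section Coupling

variable {A B C : Type*}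

lemma condCyl_le_one [MeasurableSpace A] (μ : Measure (ℕ → A)) (f : A → C) (z : ℕ → C) (m k : ℕ)
    (a : Fin (k + 1) → A) : condCyl μ f z m k a ≤ 1 :=
  ENNReal.div_le_of_le_mul (by rw [one_mul]; exact measure_mono fun ω hω => hω.2)

lemma condCyl_eq_zero [MeasurableSpace A] (μ : Measure (ℕ → A)) (f : A → C) (z : ℕ → C) {m k : ℕ}
    (a : Fin (k + 1) → A) (i : Fin (k + 1)) (him : i.1 ≤ m) (hi : f (a i) ≠ z i.1) :
    condCyl μ f z m k a = 0 := by
  have : {ω : ℕ → A | (∀ i : Fin (k + 1), ω i.1 = a i) ∧ ∀ j ≤ m, f (ω j) = z j} = ∅ := by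
    ext ω
    simp only [Set.mem_ofPred_eq, Set.mem_empty_iff_false, iff_false]
    rintro ⟨h1, h2⟩
    exact hi (by rw [← h1 i, h2 _ him])
  rw [condCyl, this, measure_empty, ENNReal.zero_div]

lemma measurable_condCyl [MeasurableSpace A] [Countable C] [MeasurableSpace C]
    [MeasurableSingletonClass C] (μ : Measure (ℕ → A)) (f : A → C) (m k : ℕ)
    (a : Fin (k + 1) → A) : Measurable fun z : ℕ → C => condCyl μ f z m k a := by
  refine measurable_of_dependsOn_initial m _ fun z z' h => ?_
  have : ∀ ω : ℕ → A, (∀ j ≤ m, f (ω j) = z j) ↔ ∀ j ≤ m, f (ω j) = z' j := fun ω =>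
    forall₂_congr fun j hj => by rw [h j hj]
  simp only [condCyl, this]

lemma condCyl_eq_tsum [MeasurableSpace A] [MeasurableSingletonClass A] [Countable A] [Countable C]
    (μ : Measure (ℕ → A)) (f : A → C) (z : ℕ → C) (m k : ℕ) (a : ℕ → A) :
    condCyl μ f z m k (fun i => a i.1) =
      ∑' x, condCyl μ f z m (k + 1) (fun i => Function.update a (k + 1) x i.1) := by
  have hmeas : ∀ (l : ℕ) (b : ℕ → A),
      MeasurableSet {ω : ℕ → A | (∀ i : Fin (l + 1), ω i.1 = b i.1) ∧ ∀ j ≤ m, f (ω j) = z j} := by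
    intro l b
    have : {ω : ℕ → A | (∀ i : Fin (l + 1), ω i.1 = b i.1) ∧ ∀ j ≤ m, f (ω j) = z j} =
        (⋂ i : Fin (l + 1), (fun ω : ℕ → A => ω i.1) ⁻¹' {b i.1}) ∩
          ⋂ j, ⋂ (_ : j ≤ m), (fun ω : ℕ → A => ω j) ⁻¹' (f ⁻¹' {z j}) := by
      ext ω; simp
    rw [this]
    exact (MeasurableSet.iInter fun i : Fin (l + 1) => measurable_pi_apply i.1 (measurableSet_singleton _)).inter
      (.iInter fun j => .iInter fun _ => measurable_pi_apply j (Set.to_countable _).measurableSet)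
  have hunion : {ω : ℕ → A | (∀ i : Fin (k + 1), ω i.1 = a i.1) ∧ ∀ j ≤ m, f (ω j) = z j} =
      ⋃ x, {ω : ℕ → A | (∀ i : Fin (k + 1 + 1), ω i.1 = Function.update a (k + 1) x i.1) ∧
        ∀ j ≤ m, f (ω j) = z j} := by
    ext ω
    simp only [Set.mem_ofPred_eq, Set.mem_iUnion, Fin.forall_iff]
    constructor
    · rintro ⟨h1, h2⟩
      refine ⟨ω (k + 1), fun i hi => ?_, h2⟩
      rcases Nat.lt_succ_iff_lt_or_eq.1 hi with h | rfl
      · rw [Function.update_of_ne h.ne, h1 i h]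
      · rw [Function.update_self]
    · rintro ⟨x, h1, h2⟩
      exact ⟨fun i hi => by rw [h1 i (by omega), Function.update_of_ne (by omega)], h2⟩
  simp only [condCyl, ENNReal.div_eq_inv_mul]
  rw [hunion, measure_iUnion _ fun x => hmeas (k + 1) _, ENNReal.tsum_mul_left]
  intro x y hxy
  refine Set.disjoint_left.2 fun ω hx hy => hxy ?_
  simpa using (hx.1 ⟨k + 1, by omega⟩).symm.trans (hy.1 ⟨k + 1, by omega⟩)

lemma condCyl_self [MeasurableSpace A] [MeasurableSingletonClass A] [Countable A] [Countable C]
    [MeasurableSpace C] [MeasurableSingletonClass C]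
    {μ : Measure (ℕ → A)} {f : A → C} {μZ : Measure (ℕ → C)}
    (hμZ : μ.map (fun ω n => f (ω n)) = μZ) (z : ℕ → C) (k : ℕ) (a : ℕ → A) :
    condCyl μ f z k k (fun i => a i.1) =
      (pathCyl k fun i => f (a i)).indicator
        (fun _ => μ (pathCyl k a) / μZ (pathCyl k fun i => f (a i))) z := by
  have hfm : Measurable f := measurable_of_countable f
  by_cases hz : z ∈ pathCyl k fun i => f (a i)
  · rw [Set.indicator_of_mem hz, ← hμZ,
      Measure.map_apply (by fun_prop) (measurableSet_pathCyl k _), condCyl]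
    congr 2
    · ext ω
      simp only [Set.mem_ofPred_eq, pathCyl, Fin.forall_iff, Nat.lt_succ_iff]
      exact ⟨fun h => h.1, fun h => ⟨h, fun j hj => by rw [h j hj, hz j hj]⟩⟩
    · ext ω
      exact forall₂_congr fun j hj => by rw [hz j hj]
  · rw [Set.indicator_of_notMem hz]
    simp only [pathCyl, Set.mem_ofPred_eq, not_forall] at hz
    obtain ⟨i, hi, h⟩ := hz
    exact condCyl_eq_zero μ f z _ ⟨i, by omega⟩ hi (Ne.symm h)

lemma measure_pathCyl_le [MeasurableSpace A] [MeasurableSingletonClass A] [Countable A]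
    [MeasurableSpace C] [MeasurableSingletonClass C]
    {μ : Measure (ℕ → A)} {f : A → C} {μZ : Measure (ℕ → C)}
    (hμZ : μ.map (fun ω n => f (ω n)) = μZ) (k : ℕ) (a : ℕ → A) :
    μ (pathCyl k a) ≤ μZ (pathCyl k fun i => f (a i)) := by
  have hfm : Measurable f := measurable_of_countable f
  rw [← hμZ, Measure.map_apply (by fun_prop) (measurableSet_pathCyl k _)]
  exact measure_mono fun ω h i hi => congrArg f (h i hi)

lemma IsMarkovChain.measure_pathCyl_zero [MeasurableSpace A] {v : A → ℝ≥0∞} {P : A → A → ℝ≥0∞}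
    {μ : Measure (ℕ → A)} (h : IsMarkovChain v P μ) (a : ℕ → A) :
    μ (pathCyl 0 a) = v (a 0) := by
  simpa [pathCyl] using h.2.2.2 0 a

lemma IsMarkovChain.measure_pathCyl_succ [MeasurableSpace A] {v : A → ℝ≥0∞} {P : A → A → ℝ≥0∞}
    {μ : Measure (ℕ → A)} (h : IsMarkovChain v P μ) (k : ℕ) (a : ℕ → A) :
    μ (pathCyl (k + 1) a) = μ (pathCyl k a) * P (a k) (a (k + 1)) := by
  have h1 := h.2.2.2 (k + 1) a
  have h2 := h.2.2.2 k a
  rw [Finset.prod_range_succ, ← mul_assoc, ← h2] at h1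
  exact h1

lemma IsStochastic.ne_top {P : A → A → ℝ≥0∞} (h : IsStochastic P) (a a' : A) : P a a' ≠ ∞ :=
  ne_top_of_le_ne_top ENNReal.one_ne_top ((ENNReal.le_tsum a').trans (h a).le)

variable [MeasurableSpace A] [MeasurableSpace B] [MeasurableSpace C]

open ProbabilityTheory

lemma measurable_zip : Measurable fun (q : (ℕ → A) × (ℕ → B)) n => (q.1 n, q.2 n) := by
  fun_prop

lemma kernel_prod_map_pathCyl [MeasurableSingletonClass A] [MeasurableSingletonClass B]
    (ν : Kernel (ℕ → C) (ℕ → A)) (ν' : Kernel (ℕ → C) (ℕ → B))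
    [IsMarkovKernel ν] [IsMarkovKernel ν'] (z : ℕ → C) (k : ℕ) (a : ℕ → A) (b : ℕ → B) :
    (ν ×ₖ ν').map (fun q n => (q.1 n, q.2 n)) z (pathCyl k fun i => (a i, b i)) =
      ν z (pathCyl k a) * ν' z (pathCyl k b) := by
  rw [Kernel.map_apply' _ measurable_zip _ (measurableSet_pathCyl _ _), Kernel.prod_apply,
    ← Measure.prod_prod]
  congr 1
  ext q
  simp [pathCyl, forall_and]

/-- The mass of the pair of paths `(a, b)` up to time `k` when the two chains are run
independently given the first `k` steps of their common image. -/
noncomputable def pathWeight (μX : Measure (ℕ → A)) (μY : Measure (ℕ → B)) (μZ : Measure (ℕ → C))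
    (f : A → C) (k : ℕ) (a : ℕ → A) (b : ℕ → B) : ℝ≥0∞ :=
  μX (pathCyl k a) * μY (pathCyl k b) / μZ (pathCyl k fun i => f (a i))

variable {αX : A → ℝ≥0∞} {PX : A → A → ℝ≥0∞} {μX : Measure (ℕ → A)}
  {αY : B → ℝ≥0∞} {PY : B → B → ℝ≥0∞} {μY : Measure (ℕ → B)}
  {αZ : C → ℝ≥0∞} {PZ : C → C → ℝ≥0∞} {μZ : Measure (ℕ → C)} {f : A → C} {g : B → C}

lemma pathWeight_congr {k : ℕ} {a a' : ℕ → A} {b b' : ℕ → B} (ha : ∀ i ≤ k, a i = a' i)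
    (hb : ∀ i ≤ k, b i = b' i) :
    pathWeight μX μY μZ f k a b = pathWeight μX μY μZ f k a' b' := by
  rw [pathWeight, pathWeight, pathCyl_congr ha, pathCyl_congr hb,
    pathCyl_congr (a := fun i => f (a i)) (b := fun i => f (a' i)) fun i hi => by rw [ha i hi]]

variable [Countable A] [MeasurableSingletonClass A] [MeasurableSingletonClass C]

lemma pathWeight_ne_top [IsProbabilityMeasure μX] [IsProbabilityMeasure μY]
    (hfX : μX.map (fun ω n => f (ω n)) = μZ) (k : ℕ) (a : ℕ → A) (b : ℕ → B) :
    pathWeight μX μY μZ f k a b ≠ ∞ := by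
  by_cases h : μZ (pathCyl k fun i => f (a i)) = 0
  · have h0 : μX (pathCyl k a) = 0 := le_antisymm (h ▸ measure_pathCyl_le hfX k a) zero_le
    simp [pathWeight, h0]
  · exact ENNReal.div_ne_top (ENNReal.mul_ne_top (measure_ne_top _ _) (measure_ne_top _ _)) h

lemma pathWeight_zero_eq (hX : IsMarkovChain αX PX μX) (hY : IsMarkovChain αY PY μY)
    (hZ : IsMarkovChain αZ PZ μZ) (hfX : μX.map (fun ω n => f (ω n)) = μZ) (a : ℕ → A)
    (b : ℕ → B) :
    pathWeight μX μY μZ f 0 a b =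
      if αZ (f (a 0)) ≠ 0 then αX (a 0) * αY (b 0) / αZ (f (a 0)) else 0 := by
  have hle := measure_pathCyl_le hfX 0 a
  rw [hX.measure_pathCyl_zero, hZ.measure_pathCyl_zero] at hle
  rw [pathWeight, hX.measure_pathCyl_zero, hY.measure_pathCyl_zero, hZ.measure_pathCyl_zero]
  split_ifs with h
  · rfl
  · rw [not_not] at h
    rw [h] at hle
    simp [le_antisymm hle zero_le]

lemma pathWeight_succ (hX : IsMarkovChain αX PX μX) (hY : IsMarkovChain αY PY μY)
    (hZ : IsMarkovChain αZ PZ μZ) (hfX : μX.map (fun ω n => f (ω n)) = μZ) (k : ℕ) (a : ℕ → A)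
    (b : ℕ → B) (hk : f (a k) = g (b k)) (hk' : f (a (k + 1)) = g (b (k + 1))) :
    pathWeight μX μY μZ f (k + 1) a b = pathWeight μX μY μZ f k a b *
      Rmat PX PY PZ f g ⟨(a k, b k), hk⟩ ⟨(a (k + 1), b (k + 1)), hk'⟩ := by
  have := hZ.1
  have hle := measure_pathCyl_le hfX (k + 1) a
  rw [hZ.measure_pathCyl_succ] at hle
  simp only [Rmat]
  split_ifs with h
  · rw [pathWeight, pathWeight, hX.measure_pathCyl_succ, hY.measure_pathCyl_succ,
      hZ.measure_pathCyl_succ, mul_mul_mul_comm, ENNReal.mul_div_mul_comm]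
    · exact .inr (hZ.2.2.1.ne_top _ _)
    · exact .inl (measure_ne_top _ _)
  · rw [not_not] at h
    rw [h, mul_zero] at hle
    rw [mul_zero, pathWeight, le_antisymm hle zero_le, zero_mul, ENNReal.zero_div]

/-- The law of the coupled chain on cylinders: the products in `hW` telescope. -/
lemma measure_pathCyl_coupled {φ : Delta f g → ℝ≥0∞}
    {μW : Measure (ℕ → {d : Delta f g // φ d ≠ 0})}
    (hX : IsMarkovChain αX PX μX) (hY : IsMarkovChain αY PY μY)
    (hZ : IsMarkovChain αZ PZ μZ) (hfX : μX.map (fun ω n => f (ω n)) = μZ)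
    (hW : IsMarkovChain (fun d => alphaW αX αY αZ f g φ d.1)
      (fun d e => Rmat PX PY PZ f g d.1 e.1 * φ e.1 / φ d.1) μW)
    (k : ℕ) (d : ℕ → {d : Delta f g // φ d ≠ 0}) :
    μW (pathCyl k d) =
      pathWeight μX μY μZ f k (fun i => (d i).1.1.1) (fun i => (d i).1.1.2) * φ (d k).1 := by
  have hfin : ∀ e : {d : Delta f g // φ d ≠ 0}, φ e.1 ≠ ∞ := by
    intro e he
    have h1 := hW.2.2.1 e
    simp [he] at h1
  induction k with
  | zero =>
    rw [hW.measure_pathCyl_zero, pathWeight_zero_eq hX hY hZ hfX, alphaW]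
    split_ifs <;> simp
  | succ k ih =>
    rw [hW.measure_pathCyl_succ, ih,
      pathWeight_succ (g := g) hX hY hZ hfX k _ _ (d k).1.2 (d (k + 1)).1.2]
    rw [mul_assoc, ENNReal.mul_div_cancel (d k).2 (hfin _), mul_assoc]

variable [Countable B] [MeasurableSingletonClass B] [Countable C]

/-- Integrating the product of the conditional probabilities given the first `k + n` steps of the
image chain gives the weights `pathWeight` corrected by the `n`-th iterate of `R` on `1`. -/
lemma lintegral_condCyl_mul_condCyl (hX : IsMarkovChain αX PX μX) (hY : IsMarkovChain αY PY μY)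
    (hZ : IsMarkovChain αZ PZ μZ) (hfX : μX.map (fun ω n => f (ω n)) = μZ)
    (hgY : μY.map (fun ω n => g (ω n)) = μZ) (n : ℕ) :
    ∀ (k : ℕ) (a : ℕ → A) (b : ℕ → B) (h : ∀ i ≤ k, f (a i) = g (b i)),
      ∫⁻ z, condCyl μX f z (k + n) k (fun i => a i.1) *
        condCyl μY g z (k + n) k (fun i => b i.1) ∂μZ =
      pathWeight μX μY μZ f k a b *
        phim (Rmat PX PY PZ f g) n ⟨(a k, b k), h k le_rfl⟩ := by
  have := hZ.1
  induction n with
  | zero =>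
    intro k a b h
    have hc : pathCyl k (fun i => g (b i)) = pathCyl k fun i => f (a i) :=
      pathCyl_congr fun i hi => (h i hi).symm
    simp only [add_zero, condCyl_self hfX, condCyl_self hgY, hc, ← Set.indicator_mul, phim, mul_one]
    rw [lintegral_indicator (measurableSet_pathCyl k _), setLIntegral_const, pathWeight]
    have hle := measure_pathCyl_le hfX k a
    have hfin := measure_ne_top μZ (pathCyl k fun i => f (a i))
    by_cases h0 : μZ (pathCyl k fun i => f (a i)) = 0
    · rw [h0] at hle ⊢
      simp [le_antisymm hle zero_le]
    · rw [mul_assoc, ENNReal.div_mul_cancel h0 hfin, ENNReal.mul_div_right_comm]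
  | succ n ih =>
    intro k a b h
    obtain ⟨u, hu⟩ : ∃ u : A → (ℕ → C) → ℝ≥0∞, u = fun x z =>
      condCyl μX f z (k + (n + 1)) (k + 1) fun i => Function.update a (k + 1) x i.1 := ⟨_, rfl⟩
    obtain ⟨v, hv⟩ : ∃ v : B → (ℕ → C) → ℝ≥0∞, v = fun y z =>
      condCyl μY g z (k + (n + 1)) (k + 1) fun i => Function.update b (k + 1) y i.1 := ⟨_, rfl⟩
    have hm : ∀ p : A × B, AEMeasurable (fun z => u p.1 z * v p.2 z) μZ := fun p => by
      subst hu hv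
      exact ((measurable_condCyl _ _ _ _ _).mul (measurable_condCyl _ _ _ _ _)).aemeasurable
    have hsum : ∫⁻ z, condCyl μX f z (k + (n + 1)) k (fun i => a i.1) *
        condCyl μY g z (k + (n + 1)) k (fun i => b i.1) ∂μZ =
        ∑' p : A × B, ∫⁻ z, u p.1 z * v p.2 z ∂μZ := by
      rw [← lintegral_tsum hm]
      refine lintegral_congr fun z => ?_
      rw [condCyl_eq_tsum μX, condCyl_eq_tsum μY, ENNReal.tsum_prod', ← ENNReal.tsum_mul_right]
      subst hu hv
      exact tsum_congr fun x => ENNReal.tsum_mul_left.symm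
    have hsupp : Function.support (fun p : A × B => ∫⁻ z, u p.1 z * v p.2 z ∂μZ) ⊆
        {p | f p.1 = g p.2} := by
      intro p hp
      by_contra hne
      refine hp ?_
      rw [← lintegral_zero (μ := μZ)]
      refine lintegral_congr fun z => ?_
      simp only [hu, hv]
      by_cases hz : f p.1 = z (k + 1)
      · rw [condCyl_eq_zero μY g z _ ⟨k + 1, by omega⟩ (by simp), mul_zero]
        simpa using fun h' => hne (hz.trans h'.symm)
      · rw [condCyl_eq_zero μX f z _ ⟨k + 1, by omega⟩ (by simp), zero_mul]
        simpa using hz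
    rw [hsum, ← tsum_subtype_eq_of_support_subset hsupp, phim, ← ENNReal.tsum_mul_left]
    refine tsum_congr fun e => ?_
    have hlt : ∀ i ≤ k, i ≠ k + 1 := fun i hi => by omega
    have hext : ∀ i ≤ k + 1,
        f (Function.update a (k + 1) e.1.1 i) = g (Function.update b (k + 1) e.1.2 i) := by
      intro i hi
      rcases Nat.le_succ_iff.1 hi with hi | rfl
      · rw [Function.update_of_ne (hlt i hi), Function.update_of_ne (hlt i hi), h i hi]
      · simp only [Function.update_self]
        exact e.2
    have hrec := ih (k + 1) _ _ hext
    rw [pathWeight_succ (g := g) hX hY hZ hfX k _ _ (hext k (by omega)) (hext _ le_rfl),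
      pathWeight_congr (a' := a) (b' := b) (fun i hi => Function.update_of_ne (hlt i hi) _ _)
        (fun i hi => Function.update_of_ne (hlt i hi) _ _), add_right_comm, add_assoc] at hrec
    simp only [Function.update_self, Function.update_of_ne (hlt k le_rfl)] at hrec
    rw [← mul_assoc]
    subst hu hv
    exact hrec

/-- The integrated product of the limiting conditional probabilities of a pair of cylinders. -/
lemma lintegral_limit_mul_limit {φ : Delta f g → ℝ≥0∞}
    (hX : IsMarkovChain αX PX μX) (hY : IsMarkovChain αY PY μY)
    (hZ : IsMarkovChain αZ PZ μZ) (hfX : μX.map (fun ω n => f (ω n)) = μZ)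
    (hgY : μY.map (fun ω n => g (ω n)) = μZ)
    (hφ : ∀ d : Delta f g,
      Tendsto (fun m => phim (Rmat PX PY PZ f g) m d) atTop (𝓝 (φ d)))
    (k : ℕ) (a : ℕ → A) (b : ℕ → B) (h : ∀ i ≤ k, f (a i) = g (b i))
    (u v : (ℕ → C) → ℝ≥0∞)
    (hu : ∀ᵐ z ∂μZ, Tendsto (fun m => condCyl μX f z m k fun i => a i.1) atTop (𝓝 (u z)))
    (hv : ∀ᵐ z ∂μZ, Tendsto (fun m => condCyl μY g z m k fun i => b i.1) atTop (𝓝 (v z))) :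
    ∫⁻ z, u z * v z ∂μZ =
      pathWeight μX μY μZ f k a b * φ ⟨(a k, b k), h k le_rfl⟩ := by
  have := hX.1
  have := hY.1
  have := hZ.1
  have hlim := tendsto_lintegral_of_dominated_convergence (μ := μZ)
    (F := fun m z => condCyl μX f z (k + m) k (fun i => a i.1) *
      condCyl μY g z (k + m) k (fun i => b i.1)) (f := fun z => u z * v z) (fun _ => 1)
    (fun m => (measurable_condCyl _ _ _ _ _).mul (measurable_condCyl _ _ _ _ _))
    (fun m => ae_of_all _ fun z => mul_le_one' (condCyl_le_one _ _ _ _ _ _)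
      (condCyl_le_one _ _ _ _ _ _)) (by simp) (by
      have hshift : Tendsto (fun m => k + m) atTop atTop :=
        tendsto_atTop_mono (fun m => Nat.le_add_left m k) tendsto_id
      filter_upwards [hu, hv] with z hz hz'
      have hle : ∀ {w : ℕ → ℝ≥0∞} {x : ℝ≥0∞}, (∀ m, w m ≤ 1) → Tendsto w atTop (𝓝 x) → x ≠ ∞ :=
        fun hw hx => ne_top_of_le_ne_top ENNReal.one_ne_top (le_of_tendsto' hx hw)
      exact ENNReal.Tendsto.mul (hz.comp hshift)
        (.inr (hle (fun m => condCyl_le_one _ _ _ _ _ _) hz')) (hz'.comp hshift)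
        (.inr (hle (fun m => condCyl_le_one _ _ _ _ _ _) hz)))
  simp only [lintegral_condCyl_mul_condCyl hX hY hZ hfX hgY _ k a b h] at hlim
  exact tendsto_nhds_unique hlim
    (ENNReal.Tendsto.const_mul (hφ _) (.inr (pathWeight_ne_top hfX k a b)))

/-- The conditionally independent coupling of `ν` and `ν'` over `μZ` has the law of the coupled
chain. -/
lemma bind_prod_eq_map_coupled {φ : Delta f g → ℝ≥0∞}
    {μW : Measure (ℕ → {d : Delta f g // φ d ≠ 0})}
    (hX : IsMarkovChain αX PX μX) (hY : IsMarkovChain αY PY μY)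
    (hZ : IsMarkovChain αZ PZ μZ) (hfX : μX.map (fun ω n => f (ω n)) = μZ)
    (hgY : μY.map (fun ω n => g (ω n)) = μZ)
    (hφ : ∀ d : Delta f g,
      Tendsto (fun m => phim (Rmat PX PY PZ f g) m d) atTop (𝓝 (φ d)))
    (hW : IsMarkovChain (fun d => alphaW αX αY αZ f g φ d.1)
      (fun d e => Rmat PX PY PZ f g d.1 e.1 * φ e.1 / φ d.1) μW)
    (ν : Kernel (ℕ → C) (ℕ → A)) (ν' : Kernel (ℕ → C) (ℕ → B))
    [IsMarkovKernel ν] [IsMarkovKernel ν']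
    (hν : ∀ (k : ℕ) (a : ℕ → A), ∀ᵐ z ∂μZ,
      Tendsto (fun m => condCyl μX f z m k fun i => a i.1) atTop (𝓝 (ν z (pathCyl k a))))
    (hν' : ∀ (k : ℕ) (b : ℕ → B), ∀ᵐ z ∂μZ,
      Tendsto (fun m => condCyl μY g z m k fun i => b i.1) atTop (𝓝 (ν' z (pathCyl k b)))) :
    μZ.bind ((ν ×ₖ ν').map fun q n => (q.1 n, q.2 n)) = μW.map fun ω n => (ω n).1.1 := by
  have := hZ.1
  have := hW.1
  have hzip := measurable_zip (A := A) (B := B)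
  have : IsMarkovKernel ((ν ×ₖ ν').map fun q n => (q.1 n, q.2 n)) :=
    Kernel.IsMarkovKernel.map _ hzip
  have hproj : Measurable fun (ω : ℕ → {d : Delta f g // φ d ≠ 0}) n => (ω n).1.1 := by fun_prop
  refine measure_ext_of_pathCyl fun k p => ?_
  have hbind : ∀ l, μZ.bind ((ν ×ₖ ν').map fun q n => (q.1 n, q.2 n)) (pathCyl l p) =
      ∫⁻ z, ν z (pathCyl l fun i => (p i).1) * ν' z (pathCyl l fun i => (p i).2) ∂μZ := by
    intro l
    rw [Measure.bind_apply (measurableSet_pathCyl l p) (Kernel.aemeasurable _)]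
    exact lintegral_congr fun z => kernel_prod_map_pathCyl ν ν' z l _ _
  have hΔ : ∀ l (h : ∀ i ≤ l, f (p i).1 = g (p i).2),
      μZ.bind ((ν ×ₖ ν').map fun q n => (q.1 n, q.2 n)) (pathCyl l p) =
      pathWeight μX μY μZ f l (fun i => (p i).1) (fun i => (p i).2) *
        φ ⟨p l, h l le_rfl⟩ := fun l h => by
    rw [hbind]
    exact lintegral_limit_mul_limit hX hY hZ hfX hgY hφ l _ _ h _ _ (hν l _) (hν' l _)
  rw [Measure.map_apply hproj (measurableSet_pathCyl k p)]
  by_cases hgood : ∀ i ≤ k, ∃ h : f (p i).1 = g (p i).2, φ ⟨p i, h⟩ ≠ 0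
  · have hmin : ∀ i, ∃ d : {d : Delta f g // φ d ≠ 0}, d.1.1 = p (min i k) := fun i => by
      obtain ⟨h, h'⟩ := hgood (min i k) (min_le_right _ _)
      exact ⟨⟨⟨p (min i k), h⟩, h'⟩, rfl⟩
    choose d hd using hmin
    have hd' : ∀ i ≤ k, (d i).1.1 = p i := fun i hi => by rw [hd, min_eq_left hi]
    have hpre : (fun (ω : ℕ → {d : Delta f g // φ d ≠ 0}) n => (ω n).1.1) ⁻¹' pathCyl k p =
        pathCyl k d := by
      ext ω
      refine forall₂_congr fun i hi => ?_
      rw [← hd' i hi, Subtype.ext_iff, Subtype.ext_iff]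
    rw [hpre, measure_pathCyl_coupled hX hY hZ hfX hW, hΔ k fun i hi => (hgood i hi).1]
    congr 1
    · exact pathWeight_congr (fun i hi => by rw [hd' i hi]) fun i hi => by rw [hd' i hi]
    · exact congrArg φ (Subtype.ext (hd' k le_rfl).symm)
  · push Not at hgood
    obtain ⟨i, hi, hbad⟩ := hgood
    have hpre : (fun (ω : ℕ → {d : Delta f g // φ d ≠ 0}) n => (ω n).1.1) ⁻¹' pathCyl k p = ∅ := by
      ext ω
      simp only [Set.mem_preimage, Set.mem_empty_iff_false, iff_false]
      intro hω
      have hωi : (ω i).1.1 = p i := hω i hi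
      have he : f (p i).1 = g (p i).2 := hωi ▸ (ω i).1.2
      exact (ω i).2 ((congrArg φ (Subtype.ext hωi)).trans (hbad he))
    rw [hpre, measure_empty]
    by_cases hall : ∀ j ≤ k, f (p j).1 = g (p j).2
    · refine le_antisymm ?_ zero_le
      calc _ ≤ μZ.bind ((ν ×ₖ ν').map fun q n => (q.1 n, q.2 n)) (pathCyl i p) :=
            measure_mono fun ω (hω : ∀ j ≤ k, ω j = p j) j hj => hω j (hj.trans hi)
        _ = 0 := by rw [hΔ i fun j hj => hall j (hj.trans hi), hbad, mul_zero]
    · push Not at hall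
      obtain ⟨j, hj, hne⟩ := hall
      rw [hbind, ← lintegral_zero (μ := μZ)]
      refine lintegral_congr_ae ?_
      filter_upwards [hν k fun i => (p i).1, hν' k fun i => (p i).2] with z hz hz'
      by_cases hzj : f (p j).1 = z j
      · rw [tendsto_nhds_unique hz' (tendsto_const_nhds.congr' ?_), mul_zero]
        filter_upwards [eventually_ge_atTop k] with m hm
        exact (condCyl_eq_zero μY g z _ ⟨j, by omega⟩ (hj.trans hm)
          fun h => hne (hzj.trans h.symm)).symm
      · rw [tendsto_nhds_unique hz (tendsto_const_nhds.congr' ?_), zero_mul]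
        filter_upwards [eventually_ge_atTop k] with m hm
        exact (condCyl_eq_zero μX f z _ ⟨j, by omega⟩ (hj.trans hm) hzj).symm

end Coupling

/-- **Disintegration via the martingale limits.** The cylinder specifications given by `L_∞`
are a.s. consistent and define a measurable family `ν z` of probability measures on `A^ℕ`
which is a regular conditional distribution of the law of `X̄` given the image process
`f(X̄) = Z`: a.s. `ν z` is supported on the fibre `{(a_i) : f(a_i) = z_i ∀i}` and
`∫ ν z dμ_Z(z)` is the law of `X̄`.  The analogous statement holds for `M_∞` and `Ȳ`, and the
products `L_∞ * M_∞` define a measurable family `ξ z` of probability measures on `(A × B)^ℕ`,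
a.s. supported on the paths in `Δ'^ℕ` projecting to `z`, which disintegrates the law of the
coupled chain `W = MC(α,P)` over `Z`. -/
theorem statement_14
    {A B C : Type*} [Countable A] [Countable B] [Countable C]
    [MeasurableSpace A] [MeasurableSingletonClass A]
    [MeasurableSpace B] [MeasurableSingletonClass B]
    [MeasurableSpace C] [MeasurableSingletonClass C]
    (αX : A → ℝ≥0∞) (PX : A → A → ℝ≥0∞) (μX : Measure (ℕ → A))
    (αY : B → ℝ≥0∞) (PY : B → B → ℝ≥0∞) (μY : Measure (ℕ → B))
    (αZ : C → ℝ≥0∞) (PZ : C → C → ℝ≥0∞) (μZ : Measure (ℕ → C))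
    (f : A → C) (g : B → C)
    (hX : IsMarkovChain αX PX μX) (hY : IsMarkovChain αY PY μY)
    (hZ : IsMarkovChain αZ PZ μZ)
    (hfX : μX.map (fun ω n => f (ω n)) = μZ)
    (hgY : μY.map (fun ω n => g (ω n)) = μZ)
    (hAvis : ∀ a : A, ∃ t : ℕ, μX {ω | ω t = a} ≠ 0)
    (hBvis : ∀ b : B, ∃ t : ℕ, μY {ω | ω t = b} ≠ 0)
    (φ : Delta f g → ℝ≥0∞)
    (hφ : ∀ d : Delta f g,
      Tendsto (fun m => phim (Rmat PX PY PZ f g) m d) atTop (𝓝 (φ d)))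
    (μW : Measure (ℕ → {d : Delta f g // φ d ≠ 0}))
    (hW : IsMarkovChain (fun d => alphaW αX αY αZ f g φ d.1)
      (fun d e => Rmat PX PY PZ f g d.1 e.1 * φ e.1 / φ d.1) μW)
    (Linf : (ℕ → C) → (k : ℕ) → (Fin (k + 1) → A) → ℝ≥0∞)
    (Minf : (ℕ → C) → (k : ℕ) → (Fin (k + 1) → B) → ℝ≥0∞)
    (hL : ∀ (k : ℕ) (a : Fin (k + 1) → A), ∀ᵐ z ∂μZ,
      Tendsto (fun m => condCyl μX f z m k a) atTop (𝓝 (Linf z k a)))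
    (hM : ∀ (k : ℕ) (b : Fin (k + 1) → B), ∀ᵐ z ∂μZ,
      Tendsto (fun m => condCyl μY g z m k b) atTop (𝓝 (Minf z k b))) :
    (∃ ν : (ℕ → C) → Measure (ℕ → A),
      Measurable ν ∧
      (∀ᵐ z ∂μZ, IsProbabilityMeasure (ν z)) ∧
      (∀ (k : ℕ) (a : Fin (k + 1) → A), ∀ᵐ z ∂μZ,
        ν z {ω | ∀ i : Fin (k + 1), ω i.1 = a i} = Linf z k a) ∧
      (∀ᵐ z ∂μZ, ν z {ω | ∀ i : ℕ, f (ω i) = z i} = 1) ∧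
      (∀ s : Set (ℕ → A), MeasurableSet s → ∫⁻ z, ν z s ∂μZ = μX s)) ∧
    (∃ ν' : (ℕ → C) → Measure (ℕ → B),
      Measurable ν' ∧
      (∀ᵐ z ∂μZ, IsProbabilityMeasure (ν' z)) ∧
      (∀ (k : ℕ) (b : Fin (k + 1) → B), ∀ᵐ z ∂μZ,
        ν' z {ω | ∀ i : Fin (k + 1), ω i.1 = b i} = Minf z k b) ∧
      (∀ᵐ z ∂μZ, ν' z {ω | ∀ i : ℕ, g (ω i) = z i} = 1) ∧
      (∀ s : Set (ℕ → B), MeasurableSet s → ∫⁻ z, ν' z s ∂μZ = μY s)) ∧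
    (∃ ξ : (ℕ → C) → Measure (ℕ → A × B),
      Measurable ξ ∧
      (∀ᵐ z ∂μZ, IsProbabilityMeasure (ξ z)) ∧
      (∀ (k : ℕ) (a : Fin (k + 1) → A) (b : Fin (k + 1) → B), ∀ᵐ z ∂μZ,
        ξ z {ω | ∀ i : Fin (k + 1), ω i.1 = (a i, b i)} = Linf z k a * Minf z k b) ∧
      (∀ᵐ z ∂μZ, ξ z {ω | ∀ i : ℕ, ∃ h : f (ω i).1 = g (ω i).2,
          f (ω i).1 = z i ∧ φ ⟨ω i, h⟩ ≠ 0} = 1) ∧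
      (∀ s : Set (ℕ → A × B), MeasurableSet s →
        ∫⁻ z, ξ z s ∂μZ = μW.map (fun ω n => (ω n).1.1) s)) := by
  have := hX.1
  have := hY.1
  have := hZ.1
  have := hW.1
  obtain ⟨ν, hν, hνlim, hνfib, hνlaw⟩ := exists_disintegration μX f μZ hfX
  obtain ⟨ν', hν', hνlim', hνfib', hνlaw'⟩ := exists_disintegration μY g μZ hgY
  have hνL : ∀ (k : ℕ) (a : Fin (k + 1) → A), ∀ᵐ z ∂μZ,
      ν z {ω | ∀ i : Fin (k + 1), ω i.1 = a i} = Linf z k a := fun k a => by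
    filter_upwards [hνlim k a, hL k a] with z h1 h2 using tendsto_nhds_unique h1 h2
  have hνM : ∀ (k : ℕ) (b : Fin (k + 1) → B), ∀ᵐ z ∂μZ,
      ν' z {ω | ∀ i : Fin (k + 1), ω i.1 = b i} = Minf z k b := fun k b => by
    filter_upwards [hνlim' k b, hM k b] with z h1 h2 using tendsto_nhds_unique h1 h2
  refine ⟨⟨ν, ν.measurable, ae_of_all _ fun z => inferInstance, hνL, hνfib, hνlaw⟩,
    ⟨ν', ν'.measurable, ae_of_all _ fun z => inferInstance, hνM, hνfib', hνlaw'⟩, ?_⟩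
  have hzip := measurable_zip (A := A) (B := B)
  have hbind := bind_prod_eq_map_coupled hX hY hZ hfX hgY hφ hW ν ν'
    (fun k a => by simpa only [setOf_forall_fin_eq_pathCyl] using hνlim k fun i => a i.1)
    (fun k b => by simpa only [setOf_forall_fin_eq_pathCyl] using hνlim' k fun i => b i.1)
  obtain ⟨ξ, hξ⟩ : ∃ ξ : ProbabilityTheory.Kernel (ℕ → C) (ℕ → A × B),
    ξ = (ProbabilityTheory.Kernel.prod ν ν').map fun q n => (q.1 n, q.2 n) := ⟨_, rfl⟩
  have hξM : ProbabilityTheory.IsMarkovKernel ξ :=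
    hξ ▸ ProbabilityTheory.Kernel.IsMarkovKernel.map _ hzip
  have hξapply : ∀ z {s}, MeasurableSet s →
      ξ z s = ((ν z).prod (ν' z)) ((fun q n => (q.1 n, q.2 n)) ⁻¹' s) := fun z s hs => by
    rw [hξ, ProbabilityTheory.Kernel.map_apply' _ hzip _ hs, ProbabilityTheory.Kernel.prod_apply]
  have hlaw : ∀ s : Set (ℕ → A × B), MeasurableSet s →
      ∫⁻ z, ξ z s ∂μZ = μW.map (fun ω n => (ω n).1.1) s := fun s hs => by
    rw [← hbind, ← hξ, Measure.bind_apply hs ξ.aemeasurable]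
  refine ⟨ξ, ξ.measurable, ae_of_all _ fun z => inferInstance, fun k a b => ?_, ?_, hlaw⟩
  · filter_upwards [hνL k a, hνM k b] with z h1 h2
    rw [← h1, ← h2, ← Measure.prod_prod, hξapply z (by
      rw [Set.ofPred_forall]
      exact .iInter fun i => measurableSet_eq_fun (by fun_prop) measurable_const)]
    congr 1
    ext q
    simp [forall_and]
  · have hgood : MeasurableSet {ω : ℕ → A × B | ∀ i,
        ∃ h : f (ω i).1 = g (ω i).2, φ ⟨ω i, h⟩ ≠ 0} := by
      rw [Set.ofPred_forall]
      exact .iInter fun i => (Set.to_countable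
        {p : A × B | ∃ h : f p.1 = g p.2, φ ⟨p, h⟩ ≠ 0}).measurableSet.preimage
          (measurable_pi_apply i)
    have hgood0 : ∫⁻ z, ξ z {ω : ℕ → A × B | ∀ i,
        ∃ h : f (ω i).1 = g (ω i).2, φ ⟨ω i, h⟩ ≠ 0}ᶜ ∂μZ = 0 := by
      rw [hlaw _ hgood.compl, Measure.map_apply (by fun_prop) hgood.compl]
      convert measure_empty (μ := μW)
      ext ω
      simpa using fun i => ⟨(ω i).1.2, (ω i).2⟩
    rw [lintegral_eq_zero_iff (ξ.measurable_coe hgood.compl)] at hgood0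
    filter_upwards [hgood0, hνfib] with z h1 h2
    have hfib : ∀ᵐ ω ∂ξ z, ∀ i, f (ω i).1 = z i := by
      have hm' : MeasurableSet {ω : ℕ → A × B | ∀ i : ℕ, f (ω i).1 = z i} := by
        have hf := measurable_of_countable f
        rw [Set.ofPred_forall]
        exact .iInter fun i => measurableSet_eq_fun (by fun_prop) measurable_const
      refine (mem_ae_iff_prob_eq_one hm').2 ?_
      rw [hξapply z hm']
      convert (Measure.prod_prod (μ := ν z) (ν := ν' z) {ω | ∀ i : ℕ, f (ω i) = z i} Set.univ)
        using 1
      · congr 1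
        ext q
        simp
      · simp [h2]
    have hmem : ∀ᵐ ω ∂ξ z, ω ∈ {ω : ℕ → A × B | ∀ i : ℕ, ∃ h : f (ω i).1 = g (ω i).2,
        f (ω i).1 = z i ∧ φ ⟨ω i, h⟩ ≠ 0} := by
      filter_upwards [hfib, (mem_ae_iff (s := {ω : ℕ → A × B | ∀ i,
        ∃ h : f (ω i).1 = g (ω i).2, φ ⟨ω i, h⟩ ≠ 0})).2 h1] with ω hω hω' i
      obtain ⟨h, h'⟩ := hω' i
      exact ⟨h, hω i, h'⟩
    rw [← measure_univ (μ := ξ z)]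
    exact measure_congr (eventuallyEq_univ.2 hmem)
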